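/- Kantorovich–Rubinstein type duality for the truncated cost: W^(λ)(μ,ν) = sup { ∫ ψ dμ − ∫ ψ dν : ψ bounded continuous, |ψ(x) − ψ(y)| ≤ d(x,y) for all x,y, and sup ψ − inf ψ ≤ 2λ }. -/

import Mathlib

open MeasureTheory

/-- The robust Wasserstein distance `W^(λ)(μ,ν)`: the infimum over couplings `π`
of `μ` and `ν` of `∫ min (d x y) (2λ) dπ`. -/
noncomputable def robustW {X : Type*} [MetricSpace X] [MeasurableSpace X]
    (l : ℝ) (μ ν : Measure X) : ℝ :=
  sInf {r : ℝ | ∃ π : Measure (X × X), IsProbabilityMeasure π ∧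
    π.map Prod.fst = μ ∧ π.map Prod.snd = ν ∧
    r = ∫ p, min (dist p.1 p.2) (2 * l) ∂π}

theorem coupling_aux {X ι : Type*} [MeasurableSpace X] [Fintype ι] [MeasurableSpace ι]
    [MeasurableSingletonClass ι] (μ ν : Measure X) [IsProbabilityMeasure μ]
    [IsProbabilityMeasure ν] (k : X → ι) (hk : Measurable k) (P : ι → ι → ENNReal)
    (h1 : ∀ i, ∑ j, P i j = μ (k ⁻¹' {i})) (h2 : ∀ j, ∑ i, P i j = ν (k ⁻¹' {j})) :
    ∃ π : Measure (X × X), π.map Prod.fst = μ ∧ π.map Prod.snd = ν ∧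
      ∀ i j, π ((fun p => (k p.1, k p.2)) ⁻¹' {(i, j)}) = P i j := by
  classical
  have hA : ∀ i, MeasurableSet (k ⁻¹' {i}) := fun i => hk (measurableSet_singleton i)
  let π : Measure (X × X) := ∑ i, ∑ j, (P i j / (μ (k ⁻¹' {i}) * ν (k ⁻¹' {j}))) •
    ((μ.restrict (k ⁻¹' {i})).prod (ν.restrict (k ⁻¹' {j})))
  have hπ : ∀ S T : Set X, MeasurableSet S → MeasurableSet T → π (S ×ˢ T) =
      ∑ i, ∑ j, (P i j / (μ (k ⁻¹' {i}) * ν (k ⁻¹' {j}))) *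
        (μ (S ∩ k ⁻¹' {i}) * ν (T ∩ k ⁻¹' {j})) := by
    intro S T hS hT
    simp only [π, Measure.finsetSum_apply, Measure.smul_apply, Measure.prod_prod,
      Measure.restrict_apply hS, Measure.restrict_apply hT, smul_eq_mul]
  have hle1 : ∀ i j, P i j ≤ μ (k ⁻¹' {i}) := fun i j => by
    rw [← h1]; exact Finset.single_le_sum (f := fun j => P i j) (fun _ _ => zero_le) (Finset.mem_univ j)
  have hle2 : ∀ i j, P i j ≤ ν (k ⁻¹' {j}) := fun i j => by
    rw [← h2]; exact Finset.single_le_sum (f := fun i => P i j) (fun _ _ => zero_le) (Finset.mem_univ i)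
  have hkey : ∀ i j, P i j / (μ (k ⁻¹' {i}) * ν (k ⁻¹' {j})) *
      (μ (k ⁻¹' {i}) * ν (k ⁻¹' {j})) = P i j := by
    intro i j
    apply ENNReal.div_mul_cancel'
    · intro h
      rcases mul_eq_zero.1 h with h | h
      · exact le_antisymm (h ▸ hle1 i j) (zero_le)
      · exact le_antisymm (h ▸ hle2 i j) (zero_le)
    · intro h
      exact absurd h (ENNReal.mul_ne_top (measure_ne_top _ _) (measure_ne_top _ _))
  have hdecomp : ∀ (ρ : Measure X) (S : Set X), MeasurableSet S → ρ S = ∑ i, ρ (S ∩ k ⁻¹' {i}) := by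
    intro ρ S hS
    have := sum_measure_preimage_singleton (μ := ρ.restrict S) (f := k) Finset.univ (fun y _ => hA y)
    simp only [Measure.restrict_apply (hA _), Finset.coe_univ, Set.preimage_univ,
      Measure.restrict_apply_univ] at this
    rw [← this]
    exact Finset.sum_congr rfl fun i _ => by rw [Set.inter_comm]
  have hfin : ∀ i, ∀ (m : ENNReal), m ≤ μ (k ⁻¹' {i}) → μ (k ⁻¹' {i}) / μ (k ⁻¹' {i}) * m = m := by
    intro i m hm
    by_cases h : μ (k ⁻¹' {i}) = 0
    · rw [h] at hm; simp [le_antisymm hm (zero_le)]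
    · rw [ENNReal.div_self h (measure_ne_top _ _), one_mul]
  have hfin2 : ∀ i, ∀ (m : ENNReal), m ≤ ν (k ⁻¹' {i}) → ν (k ⁻¹' {i}) / ν (k ⁻¹' {i}) * m = m := by
    intro i m hm
    by_cases h : ν (k ⁻¹' {i}) = 0
    · rw [h] at hm; simp [le_antisymm hm (zero_le)]
    · rw [ENNReal.div_self h (measure_ne_top _ _), one_mul]
  refine ⟨π, ?_, ?_, ?_⟩
  · ext S hS
    rw [Measure.map_apply measurable_fst hS, ← Set.prod_univ, hπ S _ hS .univ, hdecomp μ S hS]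
    refine Finset.sum_congr rfl fun i _ => ?_
    rw [← hfin i (μ (S ∩ k ⁻¹' {i})) (measure_mono Set.inter_subset_right)]
    conv_rhs => rw [← h1 i, ENNReal.div_eq_inv_mul, Finset.mul_sum, Finset.sum_mul]
    refine Finset.sum_congr rfl fun j _ => ?_
    rw [h1 i, hfin i (μ (S ∩ k ⁻¹' {i})) (measure_mono Set.inter_subset_right), Set.univ_inter]
    by_cases ha : μ (k ⁻¹' {i}) = 0
    · have : μ (S ∩ k ⁻¹' {i}) = 0 := measure_mono_null Set.inter_subset_right ha
      simp [this]
    · conv_rhs => rw [← hkey i j]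
      have := ENNReal.inv_mul_cancel ha (measure_ne_top _ _)
      calc _ = ((μ (k ⁻¹' {i}))⁻¹ * (μ (k ⁻¹' {i}))) * (P i j / (μ (k ⁻¹' {i}) * ν (k ⁻¹' {j})) *
            (μ (S ∩ k ⁻¹' {i}) * ν (k ⁻¹' {j}))) := by rw [this, one_mul]
        _ = _ := by ring
  · ext S hS
    rw [Measure.map_apply measurable_snd hS, ← Set.univ_prod, hπ _ S .univ hS, hdecomp ν S hS,
      Finset.sum_comm]
    refine Finset.sum_congr rfl fun i _ => ?_
    rw [← hfin2 i (ν (S ∩ k ⁻¹' {i})) (measure_mono Set.inter_subset_right)]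
    conv_rhs => rw [← h2 i, ENNReal.div_eq_inv_mul, Finset.mul_sum, Finset.sum_mul]
    refine Finset.sum_congr rfl fun j _ => ?_
    rw [h2 i, hfin2 i (ν (S ∩ k ⁻¹' {i})) (measure_mono Set.inter_subset_right), Set.univ_inter]
    by_cases ha : ν (k ⁻¹' {i}) = 0
    · have : ν (S ∩ k ⁻¹' {i}) = 0 := measure_mono_null Set.inter_subset_right ha
      simp [this]
    · conv_rhs => rw [← hkey j i]
      have := ENNReal.inv_mul_cancel ha (measure_ne_top _ _)
      calc _ = ((ν (k ⁻¹' {i}))⁻¹ * (ν (k ⁻¹' {i}))) * (P j i / (μ (k ⁻¹' {j}) * ν (k ⁻¹' {i})) *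
            (μ (k ⁻¹' {j}) * ν (S ∩ k ⁻¹' {i}))) := by rw [this, one_mul]
        _ = _ := by ring
  · intro i j
    have : ((fun p : X × X => (k p.1, k p.2)) ⁻¹' {(i, j)}) = (k ⁻¹' {i}) ×ˢ (k ⁻¹' {j}) := by
      ext p; simp
    rw [this, hπ _ _ (hA i) (hA j), Finset.sum_eq_single i, Finset.sum_eq_single j]
    · simp only [Set.inter_self]; exact hkey i j
    · intro j' _ hj
      have : (k ⁻¹' {j}) ∩ (k ⁻¹' {j'}) = ∅ := by
        ext x; simp only [Set.mem_inter_iff, Set.mem_preimage, Set.mem_singleton_iff,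
          Set.mem_empty_iff_false, iff_false]; rintro ⟨rfl, rfl⟩; exact hj rfl
      simp [this]
    · simp
    · intro j' _ hj
      have : (k ⁻¹' {i}) ∩ (k ⁻¹' {j'}) = ∅ := by
        ext x; simp only [Set.mem_inter_iff, Set.mem_preimage, Set.mem_singleton_iff,
          Set.mem_empty_iff_false, iff_false]; rintro ⟨rfl, rfl⟩; exact hj rfl
      simp [this]
    · simp

open scoped Pointwise in
theorem finite_duality_aux {ι : Type*} [Fintype ι] (c : ι → ι → ℝ) (a b : ι → ℝ)
    (ha : ∀ i, 0 ≤ a i) (hb : ∀ i, 0 ≤ b i) (ha1 : ∑ i, a i = 1) (hb1 : ∑ i, b i = 1) (t : ℝ)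
    (h : ∀ φ γ : ι → ℝ, (∀ i j, φ i + γ j ≤ c i j) → ∑ i, φ i * a i + ∑ j, γ j * b j ≤ t) :
    ∃ P : ι → ι → ℝ, (∀ i j, 0 ≤ P i j) ∧ (∀ i, ∑ j, P i j = a i) ∧ (∀ j, ∑ i, P i j = b j) ∧
      ∑ i, ∑ j, c i j * P i j ≤ t := by
  classical
  let A : (ι × ι → ℝ) →ₗ[ℝ] (ι → ℝ) × (ι → ℝ) × ℝ :=
    { toFun := fun P => (fun i => ∑ j, P (i, j), fun j => ∑ i, P (i, j),
        ∑ i, ∑ j, c i j * P (i, j))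
      map_add' := fun P Q => by
        ext <;> simp [Finset.sum_add_distrib, mul_add]
      map_smul' := fun r P => by
        ext <;> simp [Finset.mul_sum, mul_left_comm] }
  let R : Set ((ι → ℝ) × (ι → ℝ) × ℝ) := ({0} : Set (ι → ℝ)) ×ˢ (({0} : Set (ι → ℝ)) ×ˢ Set.Ici (0:ℝ))
  have hR : IsClosed R := isClosed_singleton.prod (isClosed_singleton.prod isClosed_Ici)
  have hRc : Convex ℝ R := (convex_singleton _).prod ((convex_singleton _).prod (convex_Ici _))
  have hScp : IsCompact (A '' stdSimplex ℝ (ι × ι)) :=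
    (isCompact_stdSimplex ℝ (ι × ι)).image (LinearMap.continuous_of_finiteDimensional A)
  have hSc : Convex ℝ (A '' stdSimplex ℝ (ι × ι)) := (convex_stdSimplex ℝ (ι × ι)).linear_image A
  by_cases hmem : (a, b, t) ∈ A '' stdSimplex ℝ (ι × ι) + R
  · obtain ⟨_, ⟨P, hP, rfl⟩, r, hr, hsum⟩ := hmem
    obtain ⟨r1, r2, r3⟩ := r
    obtain ⟨h1, h2, h3⟩ := hr
    simp only [Set.mem_singleton_iff, Set.mem_Ici] at h1 h2 h3
    subst h1 h2
    simp only [A, LinearMap.coe_mk, AddHom.coe_mk, Prod.mk_add_mk, add_zero, Prod.mk.injEq] at hsum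
    obtain ⟨e1, e2, e3⟩ := hsum
    exact ⟨fun i j => P (i, j), fun i j => hP.1 _, fun i => congrFun e1 i, fun j => congrFun e2 j,
      by linarith⟩
  exfalso
  obtain ⟨L, u, hLu, hL⟩ := geometric_hahn_banach_point_closed (hSc.add hRc)
    (hR.add_left_of_isCompact hScp) hmem
  set f : ι → ℝ := fun i => L (Pi.single i 1, 0, 0) with hf
  set g : ι → ℝ := fun j => L (0, Pi.single j 1, 0) with hg
  set k : ℝ := L (0, 0, 1) with hk
  have hrep : ∀ r s w, L (r, s, w) = ∑ i, f i * r i + ∑ j, g j * s j + k * w := by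
    intro r s w
    have e : ((r, s, w) : (ι → ℝ) × (ι → ℝ) × ℝ) =
        ∑ i, r i • ((Pi.single i 1, 0, 0) : (ι → ℝ) × (ι → ℝ) × ℝ) +
        ∑ j, s j • ((0, Pi.single j 1, 0) : (ι → ℝ) × (ι → ℝ) × ℝ) +
        w • ((0, 0, 1) : (ι → ℝ) × (ι → ℝ) × ℝ) := by
      ext <;> simp [Prod.fst_sum, Prod.snd_sum, Finset.sum_apply, Pi.single_apply]
    rw [e]
    simp only [map_add, map_sum, map_smul, smul_eq_mul, hf, hg, hk, mul_comm]
  have hpt : ∀ P ∈ stdSimplex ℝ (ι × ι), ∀ w : ℝ, 0 ≤ w →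
      u < ∑ i, f i * ∑ j, P (i, j) + ∑ j, g j * ∑ i, P (i, j) +
        k * (∑ i, ∑ j, c i j * P (i, j) + w) := by
    intro P hP w hw
    have := hL (A P + (0, 0, w)) (Set.add_mem_add ⟨P, hP, rfl⟩ ⟨rfl, rfl, hw⟩)
    simp only [A, LinearMap.coe_mk, AddHom.coe_mk, Prod.mk_add_mk, add_zero] at this
    rwa [hrep] at this
  rw [hrep] at hLu
  have hprod : (fun p : ι × ι => a p.1 * b p.2) ∈ stdSimplex ℝ (ι × ι) := by
    refine ⟨fun p => mul_nonneg (ha _) (hb _), ?_⟩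
    rw [Fintype.sum_prod_type]
    simp [← Finset.mul_sum, ha1, hb1]
  have hp2 : ∀ w : ℝ, 0 ≤ w → k * t < k * (∑ i, ∑ j, c i j * (a i * b j) + w) := by
    intro w hw
    have := hpt _ hprod w hw
    simp only [← Finset.mul_sum, ← Finset.sum_mul, hb1, ha1, mul_one, one_mul] at this
    linarith
  set C := ∑ i, ∑ j, c i j * (a i * b j) with hC
  have hkpos : 0 < k := by
    have := hp2 |t - C| (abs_nonneg _)
    have h3 : k * (C + |t - C| - t) > 0 := by linarith
    have h4 := le_abs_self (t - C)
    exact pos_of_mul_pos_left h3 (by linarith)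
  have hij : ∀ i j, u < f i + g j + k * c i j := by
    intro i j
    have := hpt (Pi.single (i, j) 1) (single_mem_stdSimplex ℝ (i, j)) 0 le_rfl
    have e1 : ∀ i', ∑ j', (Pi.single (i, j) (1:ℝ) : ι × ι → ℝ) (i', j') = if i' = i then 1 else 0 := by
      intro i'; by_cases h : i' = i <;> simp [Pi.single_apply, h]
    have e2 : ∀ j', ∑ i', (Pi.single (i, j) (1:ℝ) : ι × ι → ℝ) (i', j') = if j' = j then 1 else 0 := by
      intro j'; by_cases h : j' = j <;> simp [Pi.single_apply, h]
    have e3 : ∑ i', ∑ j', c i' j' * (Pi.single (i, j) (1:ℝ) : ι × ι → ℝ) (i', j') = c i j := by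
      rw [← Fintype.sum_prod_type' (fun i' j' => c i' j' * (Pi.single (i, j) (1:ℝ) : ι × ι → ℝ) (i', j'))]
      simp [Pi.single_apply]
    simpa [e1, e2, e3] using this
  have := h (fun i => (u - f i) / k) (fun j => - g j / k) (by
    intro i j
    rw [← add_div, div_le_iff₀ hkpos]
    linarith [hij i j])
  have e1 : ∑ i, (u - f i) / k * a i + ∑ j, - g j / k * b j =
      (u - ∑ i, f i * a i - ∑ j, g j * b j) / k := by
    have : ∑ i, (u - f i) / k * a i = (u * ∑ i, a i - ∑ i, f i * a i) / k := by
      rw [Finset.mul_sum, ← Finset.sum_sub_distrib, Finset.sum_div]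
      exact Finset.sum_congr rfl fun i _ => by ring
    have h' : ∑ j, - g j / k * b j = - (∑ j, g j * b j) / k := by
      rw [← Finset.sum_neg_distrib, Finset.sum_div]
      exact Finset.sum_congr rfl fun i _ => by ring
    rw [this, h', ha1]; ring
  rw [e1, div_le_iff₀ hkpos] at this
  linarith

theorem tcost_tri {X : Type*} [MetricSpace X] (l : ℝ) (hl : 0 < l) (x y z : X) :
    min (dist x z) (2 * l) ≤ min (dist x y) (2 * l) + min (dist y z) (2 * l) := by
  have h1 := dist_triangle x y z
  have h2 := dist_nonneg (x := x) (y := y)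
  have h3 := dist_nonneg (x := y) (y := z)
  rcases min_cases (dist x y) (2 * l) with h | h <;>
    rcases min_cases (dist y z) (2 * l) with h' | h' <;>
    rcases min_cases (dist x z) (2 * l) with h'' | h'' <;> linarith

theorem tcost_integrable {X Y : Type*} [MetricSpace X] [SecondCountableTopology X]
    [MeasurableSpace X] [BorelSpace X] [MeasurableSpace Y] (l : ℝ) (hl : 0 < l) (ρ : Measure Y)
    [IsFiniteMeasure ρ] (f g : Y → X) (hf : Measurable f) (hg : Measurable g) :
    Integrable (fun y => min (dist (f y) (g y)) (2 * l)) ρ := by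
  refine Integrable.of_bound (C := 2 * l)
    ((hf.dist hg).min measurable_const).aestronglyMeasurable (ae_of_all _ fun y => ?_)
  rw [Real.norm_of_nonneg (le_min dist_nonneg (by linarith))]
  exact min_le_right _ _

theorem robustW_le_aux {X : Type*} [MetricSpace X] [SecondCountableTopology X]
    [MeasurableSpace X] [BorelSpace X] (l : ℝ) (hl : 0 < l)
    (μ ν : Measure X) [IsProbabilityMeasure μ] [IsProbabilityMeasure ν] (S : ℝ)
    (hS : ∀ ψ : X → ℝ, Continuous ψ → (∃ C : ℝ, ∀ x, |ψ x| ≤ C) →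
        (∀ x y : X, |ψ x - ψ y| ≤ dist x y) →
        (∀ x y : X, ψ x - ψ y ≤ 2 * l) → ∫ x, ψ x ∂μ - ∫ x, ψ x ∂ν ≤ S)
    (T : SimpleFunc X X) :
    ∃ π : Measure (X × X), IsProbabilityMeasure π ∧
    π.map Prod.fst = μ ∧ π.map Prod.snd = ν ∧
    ∫ p, min (dist p.1 p.2) (2 * l) ∂π ≤ S + 2 * (∫ x, min (dist x (T x)) (2 * l) ∂μ +
      ∫ x, min (dist x (T x)) (2 * l) ∂ν) := by
  classical
  set δ := ∫ x, min (dist x (T x)) (2 * l) ∂μ with hδ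
  set η := ∫ x, min (dist x (T x)) (2 * l) ∂ν with hη
  obtain ⟨x0⟩ : Nonempty X := by
    by_contra h
    rw [not_nonempty_iff] at h
    have := measure_univ (μ := μ)
    rw [Set.univ_eq_empty_iff.2 h] at this
    simp at this
  let ι := {x // x ∈ T.range}
  let k : X → ι := fun x => ⟨T x, T.mem_range_self x⟩
  have hk : Measurable k := T.measurable.subtype_mk
  have : Nonempty ι := ⟨k x0⟩
  have hint : ∀ (ρ : Measure X) [IsProbabilityMeasure ρ] (F : ι → ℝ),
      ∑ i, F i * ρ.real (k ⁻¹' {i}) = ∫ x, F (k x) ∂ρ := by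
    intro ρ _ F
    have : IsProbabilityMeasure (ρ.map k) := Measure.isProbabilityMeasure_map hk.aemeasurable
    have e := integral_map (μ := ρ) hk.aemeasurable (f := F) (Measurable.of_discrete).aestronglyMeasurable
    rw [← e, integral_fintype (Integrable.of_finite)]
    refine Finset.sum_congr rfl fun i _ => ?_
    rw [map_measureReal_apply hk (measurableSet_singleton i), smul_eq_mul, mul_comm]
  have hone : ∀ (ρ : Measure X) [IsProbabilityMeasure ρ], ∑ i, ρ.real (k ⁻¹' {i}) = 1 := by
    intro ρ _
    have := hint ρ (fun _ => 1)
    simpa using this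
  obtain ⟨P, hP0, hP1, hP2, hPc⟩ := finite_duality_aux
    (fun i j : ι => min (dist (i : X) (j : X)) (2 * l))
    (fun i => μ.real (k ⁻¹' {i})) (fun i => ν.real (k ⁻¹' {i}))
    (fun _ => measureReal_nonneg) (fun _ => measureReal_nonneg) (hone μ) (hone ν) (S + δ + η) (by
      intro φ γ hφγ
      let Ψ : X → ℝ := fun x => Finset.univ.inf' Finset.univ_nonempty
        (fun j : ι => min (dist x (j : X)) (2 * l) - γ j)
      have hΨle : ∀ x (j : ι), Ψ x ≤ min (dist x (j : X)) (2 * l) - γ j := fun x j =>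
        Finset.inf'_le (fun j : ι => min (dist x (j : X)) (2 * l) - γ j) (Finset.mem_univ j)
      have hlip : ∀ x y, Ψ x ≤ Ψ y + min (dist x y) (2 * l) := by
        intro x y
        obtain ⟨j, _, hj⟩ := Finset.exists_mem_eq_inf' Finset.univ_nonempty
          (fun j : ι => min (dist y (j : X)) (2 * l) - γ j)
        have h1 := hΨle x j
        have h2 := tcost_tri l hl x y (j : X)
        have h3 : Ψ y = min (dist y (j : X)) (2 * l) - γ j := hj
        linarith
      have hφ : ∀ i : ι, φ i ≤ Ψ i := by
        intro i
        refine Finset.le_inf' _ _ fun j _ => ?_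
        linarith [hφγ i j]
      have hγ : ∀ j : ι, γ j ≤ - Ψ j := by
        intro j
        have := hΨle j j
        rw [dist_self, min_eq_left (by linarith)] at this
        linarith
      have habs : ∀ x y, |Ψ x - Ψ y| ≤ dist x y := by
        intro x y
        rw [abs_le]
        have h1 := hlip x y
        have h2 := hlip y x
        rw [dist_comm y x] at h2
        have h3 := min_le_left (dist x y) (2 * l)
        constructor <;> linarith
      have hosc : ∀ x y, Ψ x - Ψ y ≤ 2 * l := fun x y => by
        linarith [hlip x y, min_le_right (dist x y) (2 * l)]
      have hcont : Continuous Ψ := by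
        refine (LipschitzWith.of_dist_le_mul (K := 1) fun x y => ?_).continuous
        rw [Real.dist_eq]; simpa using habs x y
      have hbd : ∀ x, |Ψ x| ≤ |Ψ x0| + 2 * l := by
        intro x
        have h1 := hosc x x0
        have h2 := hosc x0 x
        rw [abs_le]
        have h3 := le_abs_self (Ψ x0)
        have h4 := neg_abs_le (Ψ x0)
        constructor <;> linarith
      have hmain := hS Ψ hcont ⟨_, hbd⟩ habs hosc
      have hi : ∀ (ρ : Measure X) [IsProbabilityMeasure ρ], Integrable Ψ ρ := fun ρ _ =>
        Integrable.of_bound hcont.measurable.aestronglyMeasurable _ (ae_of_all _ hbd)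
      have hiT : ∀ (ρ : Measure X) [IsProbabilityMeasure ρ], Integrable (fun x => Ψ (T x)) ρ :=
        fun ρ _ => Integrable.of_bound
          (hcont.measurable.comp T.measurable).aestronglyMeasurable _ (ae_of_all _ fun x => hbd (T x))
      have hic : ∀ (ρ : Measure X) [IsProbabilityMeasure ρ],
          Integrable (fun x => min (dist x (T x)) (2 * l)) ρ :=
        fun ρ _ => tcost_integrable l hl ρ _ _ measurable_id T.measurable
      have b1 : ∑ i, φ i * μ.real (k ⁻¹' {i}) ≤ ∫ x, Ψ x ∂μ + δ := by
        calc _ ≤ ∑ i : ι, Ψ i * μ.real (k ⁻¹' {i}) := Finset.sum_le_sum fun i _ =>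
              mul_le_mul_of_nonneg_right (hφ i) measureReal_nonneg
          _ = ∫ x, Ψ (T x) ∂μ := hint μ (fun i => Ψ i)
          _ ≤ ∫ x, (Ψ x + min (dist x (T x)) (2 * l)) ∂μ := by
              refine integral_mono (hiT μ) ((hi μ).add (hic μ)) fun x => ?_
              have := hlip (T x) x
              rwa [dist_comm] at this
          _ = _ := integral_add (hi μ) (hic μ)
      have b2 : ∑ i, γ i * ν.real (k ⁻¹' {i}) ≤ - ∫ x, Ψ x ∂ν + η := by
        calc _ ≤ ∑ i : ι, (- Ψ i) * ν.real (k ⁻¹' {i}) := Finset.sum_le_sum fun i _ =>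
              mul_le_mul_of_nonneg_right (hγ i) measureReal_nonneg
          _ = ∫ x, - Ψ (T x) ∂ν := hint ν (fun i => - Ψ i)
          _ ≤ ∫ x, (- Ψ x + min (dist x (T x)) (2 * l)) ∂ν := by
              refine integral_mono (hiT ν).neg ((hi ν).neg.add (hic ν)) fun x => ?_
              have := hlip x (T x)
              simp only
              linarith
          _ = _ := by
              rw [← integral_neg]
              exact integral_add (hi ν).neg (hic ν)
      linarith)
  obtain ⟨π, hπ1, hπ2, hπP⟩ := coupling_aux μ ν k hk (fun i j => ENNReal.ofReal (P i j))
    (fun i => by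
      rw [← ENNReal.ofReal_sum_of_nonneg (fun j _ => hP0 i j), hP1]
      exact ofReal_measureReal)
    (fun j => by
      rw [← ENNReal.ofReal_sum_of_nonneg (fun i _ => hP0 i j), hP2]
      exact ofReal_measureReal)
  have hprob : IsProbabilityMeasure π := by
    constructor
    rw [← Set.preimage_univ (f := Prod.fst), ← Measure.map_apply measurable_fst .univ, hπ1,
      measure_univ]
  refine ⟨π, hprob, hπ1, hπ2, ?_⟩
  have i1 : ∫ p, min (dist p.1 (T p.1)) (2 * l) ∂π = δ := by
    rw [hδ, ← hπ1]
    exact (integral_map measurable_fst.aemeasurable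
      ((measurable_id.dist T.measurable).min measurable_const).aestronglyMeasurable).symm
  have i2 : ∫ p, min (dist p.2 (T p.2)) (2 * l) ∂π = η := by
    rw [hη, ← hπ2]
    exact (integral_map measurable_snd.aemeasurable
      ((measurable_id.dist T.measurable).min measurable_const).aestronglyMeasurable).symm
  have hkk : Measurable (fun p : X × X => (k p.1, k p.2)) :=
    (hk.comp measurable_fst).prodMk (hk.comp measurable_snd)
  have i3 : ∫ p, min (dist (T p.1) (T p.2)) (2 * l) ∂π =
      ∑ i : ι, ∑ j : ι, min (dist (i : X) (j : X)) (2 * l) * P i j := by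
    have : IsProbabilityMeasure (π.map (fun p : X × X => (k p.1, k p.2))) :=
      Measure.isProbabilityMeasure_map hkk.aemeasurable
    have e := integral_map (μ := π) hkk.aemeasurable
      (f := fun q : ι × ι => min (dist (q.1 : X) (q.2 : X)) (2 * l))
      (Measurable.of_discrete).aestronglyMeasurable
    rw [← e, integral_fintype (Integrable.of_finite), Fintype.sum_prod_type]
    refine Finset.sum_congr rfl fun i _ => Finset.sum_congr rfl fun j _ => ?_
    rw [map_measureReal_apply hkk (measurableSet_singleton _), measureReal_def, hπP,
      ENNReal.toReal_ofReal (hP0 i j), smul_eq_mul, mul_comm]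
  have m1 : Measurable fun p : X × X => T p.1 := T.measurable.comp measurable_fst
  have m2 : Measurable fun p : X × X => T p.2 := T.measurable.comp measurable_snd
  have j1 := tcost_integrable l hl π _ _ measurable_fst m1
  have j2 := tcost_integrable l hl π _ _ measurable_snd m2
  have j3 := tcost_integrable l hl π _ _ m1 m2
  have j4 := tcost_integrable l hl π _ _ measurable_fst measurable_snd
  have := integral_mono j4 ((j1.add j3).add j2) (fun p => by
    have h1 := tcost_tri l hl p.1 (T p.1) p.2
    have h2 := tcost_tri l hl (T p.1) (T p.2) p.2
    rw [dist_comm (T p.2)] at h2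
    simp only [Pi.add_apply]
    linarith)
  rw [integral_add' (j1.add j3) j2, integral_add' j1 j3, i1, i2, i3] at this
  linarith

/-- Kantorovich–Rubinstein type duality for the truncated cost:
`W^(λ)(μ,ν)` equals the supremum of `∫ ψ dμ − ∫ ψ dν` over bounded continuous
`ψ` that are 1-Lipschitz for `d` and have oscillation at most `2λ`. -/
theorem robustW_duality {X : Type*} [MetricSpace X] [PolishSpace X]
    [MeasurableSpace X] [BorelSpace X] (l : ℝ) (hl : 0 < l)
    (μ ν : Measure X) [IsProbabilityMeasure μ] [IsProbabilityMeasure ν] :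
    robustW l μ ν =
      sSup {r : ℝ | ∃ ψ : X → ℝ, Continuous ψ ∧ (∃ C : ℝ, ∀ x, |ψ x| ≤ C) ∧
        (∀ x y : X, |ψ x - ψ y| ≤ dist x y) ∧
        (∀ x y : X, ψ x - ψ y ≤ 2 * l) ∧
        r = ∫ x, ψ x ∂μ - ∫ x, ψ x ∂ν} := by
  obtain ⟨x0⟩ : Nonempty X := by
    by_contra h
    rw [not_nonempty_iff] at h
    have := measure_univ (μ := μ)
    rw [Set.univ_eq_empty_iff.2 h] at this
    simp at this
  have : Nonempty X := ⟨x0⟩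
  set D := {r : ℝ | ∃ ψ : X → ℝ, Continuous ψ ∧ (∃ C : ℝ, ∀ x, |ψ x| ≤ C) ∧
        (∀ x y : X, |ψ x - ψ y| ≤ dist x y) ∧
        (∀ x y : X, ψ x - ψ y ≤ 2 * l) ∧
        r = ∫ x, ψ x ∂μ - ∫ x, ψ x ∂ν} with hD
  unfold robustW
  set Q := {r : ℝ | ∃ π : Measure (X × X), IsProbabilityMeasure π ∧
    π.map Prod.fst = μ ∧ π.map Prod.snd = ν ∧
    r = ∫ p, min (dist p.1 p.2) (2 * l) ∂π} with hQ
  have hQne : Q.Nonempty := ⟨_, μ.prod ν, inferInstance, by simp [Measure.map_fst_prod],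
    by simp [Measure.map_snd_prod], rfl⟩
  have hQb : BddBelow Q := by
    refine ⟨0, ?_⟩
    rintro r ⟨π, _, _, _, rfl⟩
    exact integral_nonneg fun p => le_min dist_nonneg (show (0:ℝ) ≤ 2 * l by linarith)
  have hDne : D.Nonempty := ⟨0, fun _ => 0, continuous_const, ⟨0, by simp⟩, by simp,
    fun x y => by linarith, by simp⟩
  have hweak : ∀ r ∈ D, ∀ s ∈ Q, r ≤ s := by
    rintro r ⟨ψ, hc, ⟨C, hC⟩, hL, hO, rfl⟩ s ⟨π, hπ, rfl, rfl, rfl⟩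
    rw [integral_map measurable_fst.aemeasurable hc.measurable.aestronglyMeasurable,
      integral_map measurable_snd.aemeasurable hc.measurable.aestronglyMeasurable]
    have k1 : Integrable (fun p : X × X => ψ p.1) π := Integrable.of_bound
      (hc.measurable.comp measurable_fst).aestronglyMeasurable C (ae_of_all _ fun p => hC p.1)
    have k2 : Integrable (fun p : X × X => ψ p.2) π := Integrable.of_bound
      (hc.measurable.comp measurable_snd).aestronglyMeasurable C (ae_of_all _ fun p => hC p.2)
    rw [← integral_sub k1 k2]
    exact integral_mono (k1.sub k2) (tcost_integrable l hl π _ _ measurable_fst measurable_snd)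
      fun p => le_min ((le_abs_self _).trans (hL _ _)) (hO _ _)
  have hDb : BddAbove D := hQne.elim fun s hs => ⟨s, fun r hr => hweak r hr s hs⟩
  refine le_antisymm ?_ (csSup_le hDne fun r hr => le_csInf hQne fun s hs => hweak r hr s hs)
  let T : ℕ → SimpleFunc X X := fun N => SimpleFunc.nearestPt (TopologicalSpace.denseSeq X) N
  have hlim : ∀ (ρ : Measure X) [IsProbabilityMeasure ρ],
      Filter.Tendsto (fun N => ∫ x, min (dist x (T N x)) (2 * l) ∂ρ) Filter.atTop (nhds 0) := by
    intro ρ _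
    have := tendsto_integral_of_dominated_convergence (μ := ρ)
      (F := fun N x => min (dist x (T N x)) (2 * l)) (f := fun _ => (0:ℝ)) (fun _ => 2 * l)
      (fun N => (tcost_integrable l hl ρ _ _ measurable_id (T N).measurable).aestronglyMeasurable)
      (integrable_const _)
      (fun N => ae_of_all _ fun x => by
        rw [Real.norm_of_nonneg (le_min dist_nonneg (by linarith))]
        exact min_le_right _ _)
      (ae_of_all _ fun x => by
        have h1 : Filter.Tendsto (fun N => T N x) Filter.atTop (nhds x) :=
          SimpleFunc.tendsto_nearestPt (TopologicalSpace.denseRange_denseSeq X x)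
        have h2 := ((tendsto_const_nhds (x := x)).dist h1).min (tendsto_const_nhds (x := 2 * l))
        rwa [dist_self, min_eq_left (by linarith)] at h2)
    simpa using this
  have hfin := (((hlim μ).add (hlim ν)).const_mul 2).const_add (sSup D)
  simp only [add_zero, mul_zero] at hfin
  refine ge_of_tendsto' hfin fun N => ?_
  obtain ⟨π, hp, h1, h2, h3⟩ := robustW_le_aux l hl μ ν (sSup D)
    (fun ψ a b c d => le_csSup hDb ⟨ψ, a, b, c, d, rfl⟩) (T N)
  exact (csInf_le hQb ⟨π, hp, h1, h2, rfl⟩).trans h3
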